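/- Let K be an algebraically closed field of characteristic 2 and let X = {F = 0} ⊂ ℙ³_K be an irreducible quartic surface with Sing(X) finite, where F(x₁,x₂,x₃,z) = z²·x₁² + z·G(x₁,x₂,x₃) + B(x₁,x₂,x₃) with G homogeneous of degree 3, G ≢ 0, and B homogeneous of degree 4 (so P = [0:0:0:1] is a uniplanar double point and the projection from P is separable). If x₁ divides G, then |Sing(X)| ≤ 17. -/

import Mathlib

open MvPolynomial

noncomputable section

/-- The singular locus of the surface `{F = 0} ⊆ ℙ³_K`: the set of points of `ℙ³_K` at which
`F` and all four partial derivatives of `F` vanish (tested on every representative vector). -/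
def singLocus {K : Type*} [Field K] (F : MvPolynomial (Fin 4) K) :
    Set (Projectivization K (Fin 4 → K)) :=
  {p | ∀ (v : Fin 4 → K) (hv : v ≠ 0), Projectivization.mk K v hv = p →
      (eval v F = 0 ∧ ∀ i, eval v (pderiv i F) = 0)}

section helpers

variable {K : Type*} [Field K]

lemma hom_eval_smul {σ : Type*} [Fintype σ] {n : ℕ} {p : MvPolynomial σ K}
    (hp : p.IsHomogeneous n) (c : K) (v : σ → K) :
    eval (c • v) p = c ^ n * eval v p := by
  rw [eval_eq', eval_eq', Finset.mul_sum]
  refine Finset.sum_congr rfl fun d hd => ?_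
  have h : ∑ i, d i = n := by
    have h2 : n = d.degree := hp.degree_eq_sum_deg_support hd
    rw [Finsupp.degree_eq_sum] at h2
    omega
  simp only [Pi.smul_apply, smul_eq_mul, mul_pow, Finset.prod_mul_distrib,
    Finset.prod_pow_eq_pow_sum, h]
  ring

lemma monomial3 (d : Fin 3 →₀ ℕ) (a : K) :
    monomial d a = C a * (X 0 ^ d 0 * X 1 ^ d 1 * X 2 ^ d 2) := by
  rw [monomial_eq, Finsupp.prod_fintype _ _ (by simp), Fin.prod_univ_three]

lemma hom_deg3 {n : ℕ} {p : MvPolynomial (Fin 3) K} (hp : p.IsHomogeneous n)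
    {d : Fin 3 →₀ ℕ} (hd : d ∈ p.support) : d 0 + d 1 + d 2 = n := by
  have h2 : n = d.degree := hp.degree_eq_sum_deg_support hd
  rw [Finsupp.degree_eq_sum, Fin.sum_univ_three] at h2
  omega

lemma quartic_form {B : MvPolynomial (Fin 3) K} (hB : B.IsHomogeneous 4) :
    ∃ (D : MvPolynomial (Fin 3) K) (b0 b1 b2 b3 b4 : K),
      B = X 0 * D + (C b0 * X 1 ^ 4 + C b1 * (X 1 ^ 3 * X 2) + C b2 * (X 1 ^ 2 * X 2 ^ 2)
        + C b3 * (X 1 * X 2 ^ 3) + C b4 * X 2 ^ 4) := by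
  rw [B.as_sum]
  apply Finset.sum_induction _ (fun B => ∃ (D : MvPolynomial (Fin 3) K) (b0 b1 b2 b3 b4 : K),
      B = X 0 * D + (C b0 * X 1 ^ 4 + C b1 * (X 1 ^ 3 * X 2) + C b2 * (X 1 ^ 2 * X 2 ^ 2)
        + C b3 * (X 1 * X 2 ^ 3) + C b4 * X 2 ^ 4))
  · rintro _ _ ⟨D, b0, b1, b2, b3, b4, rfl⟩ ⟨D', c0, c1, c2, c3, c4, rfl⟩
    refine ⟨D + D', b0 + c0, b1 + c1, b2 + c2, b3 + c3, b4 + c4, ?_⟩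
    simp only [map_add]; ring
  · exact ⟨0, 0, 0, 0, 0, 0, by simp⟩
  · intro d hd
    have h := hom_deg3 hB hd
    rw [monomial3]
    generalize coeff d B = a
    generalize d 0 = i at *
    generalize d 1 = j at *
    generalize d 2 = k at *
    rcases Nat.eq_zero_or_pos i with rfl | hi
    · have hj : j ≤ 4 := by omega
      obtain rfl : k = 4 - j := by omega
      interval_cases j
      · exact ⟨0, 0, 0, 0, 0, a, by simp⟩
      · exact ⟨0, 0, 0, 0, a, 0, by simp⟩
      · exact ⟨0, 0, 0, a, 0, 0, by simp⟩
      · exact ⟨0, 0, a, 0, 0, 0, by simp⟩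
      · exact ⟨0, a, 0, 0, 0, 0, by simp⟩
    · obtain ⟨i, rfl⟩ := Nat.exists_eq_succ_of_ne_zero hi.ne'
      exact ⟨C a * (X 0 ^ i * X 1 ^ j * X 2 ^ k), 0, 0, 0, 0, 0, by
        simp [pow_succ]; ring⟩

lemma conic_form {q : MvPolynomial (Fin 3) K} (hq : q.IsHomogeneous 2) :
    ∃ (a b c d e h : K),
      q = C a * X 0 ^ 2 + C b * (X 0 * X 1) + C c * (X 0 * X 2) + C d * X 1 ^ 2
        + C e * (X 1 * X 2) + C h * X 2 ^ 2 := by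
  rw [q.as_sum]
  apply Finset.sum_induction _ (fun q => ∃ (a b c d e h : K),
      q = C a * X 0 ^ 2 + C b * (X 0 * X 1) + C c * (X 0 * X 2) + C d * X 1 ^ 2
        + C e * (X 1 * X 2) + C h * X 2 ^ 2)
  · rintro _ _ ⟨b0, b1, b2, b3, b4, b5, rfl⟩ ⟨c0, c1, c2, c3, c4, c5, rfl⟩
    refine ⟨b0 + c0, b1 + c1, b2 + c2, b3 + c3, b4 + c4, b5 + c5, ?_⟩
    simp only [map_add]; ring
  · exact ⟨0, 0, 0, 0, 0, 0, by simp⟩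
  · intro d hd
    have h := hom_deg3 hq hd
    rw [monomial3]
    generalize coeff d q = a
    generalize d 0 = i at *
    generalize d 1 = j at *
    generalize d 2 = k at *
    have hi : i ≤ 2 := by omega
    have hj : j ≤ 2 := by omega
    obtain rfl : k = 2 - i - j := by omega
    interval_cases i <;> interval_cases j <;> simp at h
    · exact ⟨0, 0, 0, 0, 0, a, by simp⟩
    · exact ⟨0, 0, 0, 0, a, 0, by simp⟩
    · exact ⟨0, 0, 0, a, 0, 0, by simp⟩
    · exact ⟨0, 0, a, 0, 0, 0, by simp⟩
    · exact ⟨0, a, 0, 0, 0, 0, by simp⟩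
    · exact ⟨a, 0, 0, 0, 0, 0, by simp⟩

lemma hom_of_X_mul {q : MvPolynomial (Fin 3) K} {n : ℕ}
    (h : (X 0 * q).IsHomogeneous (n + 1)) : q.IsHomogeneous n := by
  intro d hd
  have h1 : coeff (Finsupp.single 0 1 + d) (X 0 * q) ≠ 0 := by rwa [coeff_X_mul]
  have h2 := h h1
  rw [map_add] at h2
  simp [Finsupp.weight_single] at h2
  omega

/-- Counting parameters on a rational curve. -/
lemma param_count {f g : MvPolynomial (Fin 3) K} (hf : f.totalDegree ≤ 6)
    (hg : g.totalDegree ≤ 6) {d : ℕ} (φ : Fin 3 → Polynomial K) (hφ : ∀ i, (φ i).natDegree ≤ d)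
    (A : Set (K × K)) (hA : A.Finite) (ψ : K → K × K) (T : Set K) (hT : T.Infinite)
    (hinj : Set.InjOn ψ T)
    (hTA : ∀ t ∈ T, eval (fun i => (φ i).eval t) f = 0 → eval (fun i => (φ i).eval t) g = 0 →
      ψ t ∈ A)
    (S : Set K) (hS : ∀ t ∈ S, eval (fun i => (φ i).eval t) f = 0 ∧
      eval (fun i => (φ i).eval t) g = 0) :
    S.Finite ∧ S.ncard ≤ 6 * d := by
  have key : ∀ (p : MvPolynomial (Fin 3) K) (t : K),
      (aeval φ p).eval t = eval (fun i => (φ i).eval t) p := by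
    intro p t
    induction p using MvPolynomial.induction_on with
    | C a => simp
    | add p q hp hq => simp [hp, hq]
    | mul_X p i hp => simp [hp]
  have poly : ∀ p : Polynomial K, p ≠ 0 → p.natDegree ≤ 6 * d → (∀ t ∈ S, p.eval t = 0) →
      S.Finite ∧ S.ncard ≤ 6 * d := by
    intro p hp hd h
    classical
    have hsub : S ⊆ (p.roots.toFinset : Set K) := by
      intro t ht
      simp [hp, h t ht]
    refine ⟨(Finset.finite_toSet _).subset hsub, ?_⟩
    calc S.ncard ≤ (p.roots.toFinset : Set K).ncard :=
          Set.ncard_le_ncard hsub (Finset.finite_toSet _)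
      _ = p.roots.toFinset.card := Set.ncard_coe_finset _
      _ ≤ Multiset.card p.roots := Multiset.toFinset_card_le _
      _ ≤ p.natDegree := p.card_roots'
      _ ≤ _ := hd
  by_cases h1 : aeval φ f = 0
  · by_cases h2 : aeval φ g = 0
    · exfalso
      have : ψ '' T ⊆ A := by
        rintro _ ⟨t, ht, rfl⟩
        refine hTA t ht ?_ ?_
        · rw [← key, h1]; simp
        · rw [← key, h2]; simp
      exact (hT.image hinj) (hA.subset this)
    · exact poly _ h2 (aeval_natDegree_le g hg φ hφ) fun t ht => by rw [key]; exact (hS t ht).2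
  · exact poly _ h1 (aeval_natDegree_le f hf φ hφ) fun t ht => by rw [key]; exact (hS t ht).1

lemma line_count [Infinite K] {f g : MvPolynomial (Fin 3) K} (hf : f.totalDegree ≤ 6)
    (hg : g.totalDegree ≤ 6) (A : Set (K × K)) (hA : A.Finite) (α β γ : K)
    (hne : ¬ (α = 0 ∧ β = 0 ∧ γ = 0))
    (hA1 : ∀ p ∈ A, eval ![1, p.1, p.2] f = 0 ∧ eval ![1, p.1, p.2] g = 0)
    (hA2 : ∀ y w : K, α + β * y + γ * w = 0 → eval ![1, y, w] f = 0 → eval ![1, y, w] g = 0 →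
      (y, w) ∈ A) :
    {p ∈ A | α + β * p.1 + γ * p.2 = 0}.ncard ≤ 6 := by
  -- a general parametrised line
  have main : ∀ (u v r s : K) (ψ : K → K × K), (∀ t, ψ t = (u + r * t, v + s * t)) →
      Function.Injective ψ → (∀ t, α + β * (ψ t).1 + γ * (ψ t).2 = 0) →
      (∀ p : K × K, α + β * p.1 + γ * p.2 = 0 → ∃ t, ψ t = p) →
      {p ∈ A | α + β * p.1 + γ * p.2 = 0}.ncard ≤ 6 := by
    intro u v r s ψ hψ hinj hon hsurj
    let φ : Fin 3 → Polynomial K := ![1, Polynomial.C r * Polynomial.X + Polynomial.C u,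
      Polynomial.C s * Polynomial.X + Polynomial.C v]
    have hφ : ∀ t, (fun i => (φ i).eval t) = ![1, (ψ t).1, (ψ t).2] := by
      intro t
      funext i
      fin_cases i <;> simp [φ, hψ] <;> ring
    obtain ⟨h1, h2⟩ := param_count hf hg (d := 1) φ (by
        intro i
        fin_cases i
        · simp [φ]
        · exact Polynomial.natDegree_linear_le
        · exact Polynomial.natDegree_linear_le) A hA ψ Set.univ Set.infinite_univ hinj.injOn
      (by
        intro t _ h1 h2
        rw [hφ] at h1 h2
        exact hA2 _ _ (hon t) h1 h2)
      {t | ψ t ∈ A} (by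
        intro t ht
        rw [hφ]
        exact hA1 _ ht)
    have hsub : {p ∈ A | α + β * p.1 + γ * p.2 = 0} ⊆ ψ '' {t | ψ t ∈ A} := by
      rintro p ⟨hp, hp2⟩
      obtain ⟨t, rfl⟩ := hsurj p hp2
      exact ⟨t, hp, rfl⟩
    calc _ ≤ (ψ '' {t | ψ t ∈ A}).ncard := Set.ncard_le_ncard hsub (h1.image _)
      _ ≤ _ := Set.ncard_image_le h1
      _ ≤ 6 := by simpa using h2
  by_cases hγ : γ = 0
  · by_cases hβ : β = 0
    · have : {p ∈ A | α + β * p.1 + γ * p.2 = 0} = ∅ := by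
        ext p
        simp [hγ, hβ]
        intro _ h
        exact hne ⟨h, hβ, hγ⟩
      rw [this]; simp
    · refine main (-α / β) 0 0 1 (fun t => (-α / β, t)) (by simp) ?_ ?_ ?_
      · intro t t' h
        simpa using h
      · intro t
        simp only [hγ]
        field_simp
        ring
      · rintro ⟨y, w⟩ h
        refine ⟨w, ?_⟩
        simp only [hγ] at h
        ext
        · simp only
          field_simp
          linear_combination -h
        · rfl
  · refine main 0 (-α / γ) 1 (-β / γ) (fun t => (t, -α / γ + -β / γ * t)) (by simp) ?_ ?_ ?_
    · intro t t' h
      simpa using congrArg Prod.fst h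
    · intro t
      simp only
      field_simp
      ring
    · rintro ⟨y, w⟩ h
      refine ⟨y, ?_⟩
      ext
      · rfl
      · simp only at h ⊢
        field_simp
        linear_combination -h

lemma two_lines_count [Infinite K] {f g : MvPolynomial (Fin 3) K} (hf : f.totalDegree ≤ 6)
    (hg : g.totalDegree ≤ 6) (A : Set (K × K)) (hA : A.Finite) (α β γ α' β' γ' : K)
    (hne : ¬ (α = 0 ∧ β = 0 ∧ γ = 0)) (hne' : ¬ (α' = 0 ∧ β' = 0 ∧ γ' = 0))
    (hA1 : ∀ p ∈ A, eval ![1, p.1, p.2] f = 0 ∧ eval ![1, p.1, p.2] g = 0)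
    (hA0 : ∀ p ∈ A, (α + β * p.1 + γ * p.2) * (α' + β' * p.1 + γ' * p.2) = 0)
    (hA2 : ∀ y w : K, (α + β * y + γ * w) * (α' + β' * y + γ' * w) = 0 →
      eval ![1, y, w] f = 0 → eval ![1, y, w] g = 0 → (y, w) ∈ A) :
    A.ncard ≤ 12 := by
  have h1 := line_count hf hg A hA α β γ hne hA1
    (fun y w h => hA2 y w (by rw [h, zero_mul]))
  have h2 := line_count hf hg A hA α' β' γ' hne' hA1
    (fun y w h => hA2 y w (by rw [h, mul_zero]))
  have hsub : A ⊆ {p ∈ A | α + β * p.1 + γ * p.2 = 0} ∪ {p ∈ A | α' + β' * p.1 + γ' * p.2 = 0} := by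
    intro p hp
    rcases mul_eq_zero.1 (hA0 p hp) with h | h
    · exact Or.inl ⟨hp, h⟩
    · exact Or.inr ⟨hp, h⟩
  calc A.ncard ≤ _ := Set.ncard_le_ncard hsub ((hA.subset (Set.sep_subset _ _)).union
          (hA.subset (Set.sep_subset _ _)))
    _ ≤ _ := Set.ncard_union_le _ _
    _ ≤ 12 := by omega

lemma affine_count [IsAlgClosed K] [CharP K 2] {f g : MvPolynomial (Fin 3) K}
    (hf : f.IsHomogeneous 6) (hg : g.IsHomogeneous 6) (a b c d e h : K)
    (hne : ¬ (a = 0 ∧ b = 0 ∧ c = 0 ∧ d = 0 ∧ e = 0 ∧ h = 0))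
    (A : Set (K × K)) (hA : A.Finite)
    (hAdef : ∀ y w : K, (y, w) ∈ A ↔
      (a + b * y + c * w + d * y ^ 2 + e * (y * w) + h * w ^ 2 = 0 ∧
        eval ![1, y, w] f = 0 ∧ eval ![1, y, w] g = 0)) :
    A.ncard ≤ 14 := by
  have : Infinite K := IsAlgClosed.instInfinite
  have two : (2 : K) = 0 := CharTwo.two_eq_zero
  rcases A.eq_empty_or_nonempty with rfl | ⟨⟨y0, w0⟩, h0⟩
  · simp
  obtain ⟨hq0, -⟩ := (hAdef _ _).1 h0
  have hf' := hf.totalDegree_le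
  have hg' := hg.totalDegree_le
  have hA1 : ∀ p ∈ A, eval ![1, p.1, p.2] f = 0 ∧ eval ![1, p.1, p.2] g = 0 :=
    fun p hp => ((hAdef p.1 p.2).1 hp).2
  -- translated coefficients
  obtain ⟨l1, hl1⟩ : ∃ l, l = b + e * w0 := ⟨_, rfl⟩
  obtain ⟨l2, hl2⟩ : ∃ l, l = c + e * y0 := ⟨_, rfl⟩
  have hq : ∀ y w : K, a + b * y + c * w + d * y ^ 2 + e * (y * w) + h * w ^ 2 =
      l1 * (y - y0) + l2 * (w - w0) + d * (y - y0) ^ 2 + e * ((y - y0) * (w - w0))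
        + h * (w - w0) ^ 2 := by
    intro y w
    rw [hl1, hl2]
    linear_combination hq0 + (d * y0 * y + h * w0 * w - d * y0 ^ 2 - h * w0 ^ 2) * two
  -- vertical line through the point contained in the conic
  by_cases hv : l2 = 0 ∧ h = 0
  · obtain ⟨hv1, hv2⟩ := hv
    have hfac : ∀ y w : K, a + b * y + c * w + d * y ^ 2 + e * (y * w) + h * w ^ 2 =
        (-y0 + 1 * y + 0 * w) * (l1 - d * y0 - e * w0 + d * y + e * w) := by
      intro y w
      rw [hq, hv1, hv2]; ring
    refine (two_lines_count hf' hg' A hA (-y0) 1 0 (l1 - d * y0 - e * w0) d e (by simp) ?_ hA1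
      (fun p hp => ?_) (fun y w h1 h2 h3 => ?_)).trans (by norm_num)
    · rintro ⟨h1, h2, h3⟩
      subst h2 h3 hv2
      simp only [zero_mul, add_zero, sub_zero] at *
      exact hne ⟨by rw [← hl1, ← hl2, h1, hv1] at hq0; simpa using hq0, by rw [← hl1, h1],
        by rw [← hl2, hv1], trivial, trivial, trivial⟩
    · rw [← hfac]; exact ((hAdef p.1 p.2).1 hp).1
    · exact (hAdef _ _).2 ⟨by rw [hfac]; exact h1, h2, h3⟩
  by_cases hr : ∃ t0, l1 + l2 * t0 = 0 ∧ d + e * t0 + h * t0 ^ 2 = 0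
  · obtain ⟨t0, hr1, hr2⟩ := hr
    have hfac : ∀ y w : K, a + b * y + c * w + d * y ^ 2 + e * (y * w) + h * w ^ 2 =
        ((t0 * y0 - w0) + (-t0) * y + 1 * w) *
          ((l2 - h * w0 - (e + h * t0) * y0) + (e + h * t0) * y + h * w) := by
      intro y w
      rw [hq]
      linear_combination (y - y0) * hr1 + (y - y0) ^ 2 * hr2
    refine (two_lines_count hf' hg' A hA (t0 * y0 - w0) (-t0) 1 (l2 - h * w0 - (e + h * t0) * y0)
      (e + h * t0) h (by simp) ?_ hA1
      (fun p hp => ?_) (fun y w h1 h2 h3 => ?_)).trans (by norm_num)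
    · rintro ⟨h1, h2, h3⟩
      exact hv ⟨by rw [h2, h3] at h1; simpa using h1, h3⟩
    · rw [← hfac]; exact ((hAdef p.1 p.2).1 hp).1
    · exact (hAdef _ _).2 ⟨by rw [hfac]; exact h1, h2, h3⟩
  -- the irreducible case
  let L : Polynomial K := Polynomial.C l2 * Polynomial.X + Polynomial.C l1
  let Q : Polynomial K := Polynomial.C h * Polynomial.X ^ 2 + Polynomial.C e * Polynomial.X
    + Polynomial.C d
  have hLe : ∀ t, L.eval t = l1 + l2 * t := by intro t; simp [L]; ring
  have hQe : ∀ t, Q.eval t = d + e * t + h * t ^ 2 := by intro t; simp [Q]; ring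
  have hLd : L.natDegree ≤ 1 := Polynomial.natDegree_linear_le
  have hQd : Q.natDegree ≤ 2 := Polynomial.natDegree_quadratic_le
  have hL0 : L ≠ 0 := by
    intro hL
    have e1 : l2 = 0 := by simpa [L] using congrArg (fun p => p.coeff 1) hL
    have e0 : l1 = 0 := by simpa [L] using congrArg (fun p => p.coeff 0) hL
    have hh : h ≠ 0 := fun hh => hv ⟨e1, hh⟩
    obtain ⟨t, ht⟩ := IsAlgClosed.exists_root Q (by
      rw [show Q.degree = 2 from Polynomial.degree_quadratic hh]; decide)
    exact hr ⟨t, by rw [e0, e1]; ring, by rw [← hQe]; exact ht⟩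
  have hQ0 : Q ≠ 0 := by
    intro hQ
    have e2 : h = 0 := by simpa [Q] using congrArg (fun p => p.coeff 2) hQ
    have hl : l2 ≠ 0 := fun hh => hv ⟨hh, e2⟩
    refine hr ⟨-l1 / l2, by field_simp; ring, ?_⟩
    rw [← hQe, hQ]; simp
  have hT : {t | (L * Q).eval t ≠ 0}.Infinite := by
    have hfin : {t | (L * Q).IsRoot t}.Finite := Polynomial.finite_setOfPred_isRoot (mul_ne_zero hL0 hQ0)
    exact hfin.infinite_compl
  let φ : Fin 3 → Polynomial K := ![Q, Polynomial.C y0 * Q + L,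
    Polynomial.C w0 * Q + Polynomial.X * L]
  let ψ : K → K × K := fun t => (y0 + L.eval t / Q.eval t, w0 + t * (L.eval t / Q.eval t))
  have hψ : ∀ t, Q.eval t ≠ 0 → (fun i => (φ i).eval t) = (Q.eval t) • ![1, (ψ t).1, (ψ t).2] := by
    intro t ht
    funext i
    fin_cases i
    · simp [φ]
    · simp [φ, ψ]; field_simp
    · simp [φ, ψ]; field_simp
  have hcon : ∀ t, Q.eval t ≠ 0 → a + b * (ψ t).1 + c * (ψ t).2 + d * (ψ t).1 ^ 2
      + e * ((ψ t).1 * (ψ t).2) + h * (ψ t).2 ^ 2 = 0 := by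
    intro t ht
    rw [hq]
    obtain ⟨s, hs⟩ : ∃ s, s = L.eval t / Q.eval t := ⟨_, rfl⟩
    have hs' : s * Q.eval t = L.eval t := by rw [hs]; field_simp
    simp only [ψ, ← hs]
    rw [hLe, hQe] at hs'
    linear_combination s * hs' + s * (l1 + l2 * t) * two
  have hφd : ∀ i, (φ i).natDegree ≤ 2 := by
    intro i
    fin_cases i
    · exact hQd
    · refine Polynomial.natDegree_add_le_of_degree_le ?_ (hLd.trans (by norm_num))
      exact (Polynomial.natDegree_C_mul_le _ _).trans hQd
    · refine Polynomial.natDegree_add_le_of_degree_le ?_ ?_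
      · exact (Polynomial.natDegree_C_mul_le _ _).trans hQd
      · refine Polynomial.natDegree_mul_le.trans ?_
        have := Polynomial.natDegree_X_le (R := K)
        omega
  obtain ⟨hS1, hS2⟩ := param_count hf' hg' φ hφd A hA ψ _ hT (by
      intro t ht t' ht' hh
      simp only [Polynomial.eval_mul, ne_eq, mul_eq_zero, not_or, Set.mem_ofPred_eq] at ht ht'
      simp only [ψ, Prod.mk.injEq, add_right_inj] at hh
      obtain ⟨h1, h2⟩ := hh
      rw [← h1] at h2
      exact mul_right_cancel₀ (div_ne_zero ht.1 ht.2) h2)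
    (by
      intro t ht h1 h2
      simp only [Polynomial.eval_mul, ne_eq, mul_eq_zero, not_or, Set.mem_ofPred_eq] at ht
      rw [hψ t ht.2, hom_eval_smul hf] at h1
      rw [hψ t ht.2, hom_eval_smul hg] at h2
      have hp := pow_ne_zero 6 ht.2
      exact (hAdef _ _).2 ⟨hcon t ht.2, (mul_eq_zero.1 h1).resolve_left hp,
        (mul_eq_zero.1 h2).resolve_left hp⟩)
    {t | Q.eval t ≠ 0 ∧ ψ t ∈ A} (by
      rintro t ⟨ht, htA⟩
      rw [hψ t ht, hom_eval_smul hf, hom_eval_smul hg, (hA1 _ htA).1, (hA1 _ htA).2]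
      simp)
  have hsub : A ⊆ {(y0, w0), (y0, w0 - l2 / h)} ∪ ψ '' {t | Q.eval t ≠ 0 ∧ ψ t ∈ A} := by
    rintro ⟨y, w⟩ hp
    obtain ⟨hp0, -⟩ := (hAdef _ _).1 hp
    rw [hq] at hp0
    by_cases hy : y = y0
    · left
      subst hy
      have h1 : (w - w0) * (l2 + h * (w - w0)) = 0 := by linear_combination hp0
      rcases mul_eq_zero.1 h1 with h1 | h1
      · left
        rw [sub_eq_zero.1 h1]
      · right
        have hh : h ≠ 0 := by
          rintro rfl
          exact hv ⟨by simpa using h1, rfl⟩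
        have : w = w0 - l2 / h := by
          field_simp
          linear_combination h1
        rw [this]; rfl
    · right
      have hy' : y - y0 ≠ 0 := sub_ne_zero.2 hy
      obtain ⟨s, hs⟩ : ∃ s, s = y - y0 := ⟨_, rfl⟩
      obtain ⟨t, ht⟩ : ∃ t, t = (w - w0) / s := ⟨_, rfl⟩
      have hs0 : s ≠ 0 := hs ▸ hy'
      have ht' : w - w0 = t * s := by rw [ht]; field_simp
      rw [ht', ← hs] at hp0
      have h1 : L.eval t + s * Q.eval t = 0 := by
        rw [hLe, hQe]
        apply mul_left_cancel₀ hs0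
        linear_combination hp0
      have hQt : Q.eval t ≠ 0 := by
        intro hQt
        rw [hQt, mul_zero, add_zero] at h1
        exact hr ⟨t, by rw [← hLe]; exact h1, by rw [← hQe]; exact hQt⟩
      have h2 : L.eval t / Q.eval t = s := by
        field_simp
        linear_combination h1 - s * Q.eval t * two
      have h3 : ψ t = (y, w) := by
        simp only [ψ, h2]
        ext
        · simp [hs]
        · simp only; rw [← ht']; ring
      exact ⟨t, ⟨hQt, by rw [h3]; exact hp⟩, h3⟩
  calc A.ncard ≤ _ := Set.ncard_le_ncard hsub ((Set.toFinite _).union (hS1.image _))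
    _ ≤ _ := Set.ncard_union_le _ _
    _ ≤ 2 + 12 := Nat.add_le_add (Set.ncard_insert_le _ _ |>.trans (by simp))
        ((Set.ncard_image_le hS1).trans hS2)
    _ = 14 := rfl

lemma sing_mem {F : MvPolynomial (Fin 4) K} (hF : F.IsHomogeneous 4) (v : Fin 4 → K) (hv : v ≠ 0) :
    Projectivization.mk K v hv ∈ singLocus F ↔
      (eval v F = 0 ∧ ∀ i, eval v (pderiv i F) = 0) := by
  constructor
  · intro h
    exact h v hv rfl
  · rintro ⟨h1, h2⟩ u hu huv
    obtain ⟨c, rfl⟩ := (Projectivization.mk_eq_mk_iff' K u v hu hv).1 huv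
    refine ⟨?_, fun i => ?_⟩
    · rw [hom_eval_smul hF, h1, mul_zero]
    · rw [hom_eval_smul (hF.pderiv (i := i)), h2, mul_zero]

lemma sing_iff [CharP K 2] (q B : MvPolynomial (Fin 3) K) (F : MvPolynomial (Fin 4) K)
    (hF : F = X 3 ^ 2 * X 0 ^ 2
        + X 3 * rename (Fin.castLE (by norm_num : (3:ℕ) ≤ 4)) (X 0 * q)
        + rename (Fin.castLE (by norm_num : (3:ℕ) ≤ 4)) B) (x y w z : K) :
    (eval ![x, y, w, z] F = 0 ∧ ∀ i, eval ![x, y, w, z] (pderiv i F) = 0) ↔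
      (z ^ 2 * x ^ 2 + z * (x * eval ![x, y, w] q) + eval ![x, y, w] B = 0 ∧
       z * (eval ![x, y, w] q + x * eval ![x, y, w] (pderiv 0 q))
        + eval ![x, y, w] (pderiv 0 B) = 0 ∧
       z * (x * eval ![x, y, w] (pderiv 1 q)) + eval ![x, y, w] (pderiv 1 B) = 0 ∧
       z * (x * eval ![x, y, w] (pderiv 2 q)) + eval ![x, y, w] (pderiv 2 B) = 0 ∧
       x * eval ![x, y, w] q = 0) := by
  have two : (2 : K) = 0 := CharTwo.two_eq_zero
  have hinj : Function.Injective (Fin.castLE (by norm_num : (3:ℕ) ≤ 4)) := Fin.castLE_injective _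
  have hr : ∀ p : MvPolynomial (Fin 3) K,
      eval ![x, y, w, z] (rename (Fin.castLE (by norm_num : (3:ℕ) ≤ 4)) p)
        = eval ![x, y, w] p := by
    intro p
    rw [eval_rename]
    congr 2
    funext i
    fin_cases i <;> rfl
  have d0 : ∀ p : MvPolynomial (Fin 3) K,
      pderiv 0 (rename (Fin.castLE (by norm_num : (3:ℕ) ≤ 4)) p) =
        rename (Fin.castLE (by norm_num : (3:ℕ) ≤ 4)) (pderiv 0 p) :=
    fun p => pderiv_rename hinj (0 : Fin 3) p
  have d1 : ∀ p : MvPolynomial (Fin 3) K,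
      pderiv 1 (rename (Fin.castLE (by norm_num : (3:ℕ) ≤ 4)) p) =
        rename (Fin.castLE (by norm_num : (3:ℕ) ≤ 4)) (pderiv 1 p) :=
    fun p => pderiv_rename hinj (1 : Fin 3) p
  have d2 : ∀ p : MvPolynomial (Fin 3) K,
      pderiv 2 (rename (Fin.castLE (by norm_num : (3:ℕ) ≤ 4)) p) =
        rename (Fin.castLE (by norm_num : (3:ℕ) ≤ 4)) (pderiv 2 p) :=
    fun p => pderiv_rename hinj (2 : Fin 3) p
  have d3 : ∀ p : MvPolynomial (Fin 3) K,
      pderiv 3 (rename (Fin.castLE (by norm_num : (3:ℕ) ≤ 4)) p) = 0 := by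
    intro p
    classical
    apply pderiv_eq_zero_of_notMem_vars
    intro hm
    obtain ⟨i, -, hi⟩ := Finset.mem_image.1 (vars_rename _ p hm)
    have := congrArg Fin.val hi
    have h2 := i.2
    simp at this
    omega
  have e0 : eval ![x, y, w, z] F = z ^ 2 * x ^ 2 + z * (x * eval ![x, y, w] q)
      + eval ![x, y, w] B := by
    rw [hF]
    simp only [map_add, map_mul, map_pow, eval_X, hr]
    simp
  have e1 : eval ![x, y, w, z] (pderiv 0 F) =
      z * (eval ![x, y, w] q + x * eval ![x, y, w] (pderiv 0 q))
        + eval ![x, y, w] (pderiv 0 B) := by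
    rw [hF]
    simp only [map_add, pderiv_mul, pderiv_pow, d0, hr, eval_X, map_mul, map_pow, pderiv_X_self,
      pderiv_X_of_ne (show (3 : Fin 4) ≠ 0 by decide)]
    simp [two]
  have e2 : eval ![x, y, w, z] (pderiv 1 F) =
      z * (x * eval ![x, y, w] (pderiv 1 q)) + eval ![x, y, w] (pderiv 1 B) := by
    rw [hF]
    simp only [map_add, pderiv_mul, pderiv_pow, d1, hr, eval_X, map_mul, map_pow, pderiv_X_self,
      pderiv_X_of_ne (show (3 : Fin 4) ≠ 1 by decide),
      pderiv_X_of_ne (show (0 : Fin 4) ≠ 1 by decide),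
      pderiv_X_of_ne (show (0 : Fin 3) ≠ 1 by decide)]
    simp
  have e3 : eval ![x, y, w, z] (pderiv 2 F) =
      z * (x * eval ![x, y, w] (pderiv 2 q)) + eval ![x, y, w] (pderiv 2 B) := by
    rw [hF]
    simp only [map_add, pderiv_mul, pderiv_pow, d2, hr, eval_X, map_mul, map_pow, pderiv_X_self,
      pderiv_X_of_ne (show (3 : Fin 4) ≠ 2 by decide),
      pderiv_X_of_ne (show (0 : Fin 4) ≠ 2 by decide),
      pderiv_X_of_ne (show (0 : Fin 3) ≠ 2 by decide)]
    simp
  have e4 : eval ![x, y, w, z] (pderiv 3 F) = x * eval ![x, y, w] q := by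
    rw [hF]
    simp only [map_add, pderiv_mul, pderiv_pow, d3, hr, eval_X, map_mul, map_pow, pderiv_X_self,
      pderiv_X_of_ne (show (0 : Fin 4) ≠ 3 by decide)]
    simp [two]
  rw [Fin.forall_fin_succ, Fin.forall_fin_succ, Fin.forall_fin_succ, Fin.forall_fin_one]
  change (_ ∧ eval _ (pderiv 0 F) = 0 ∧ eval _ (pderiv 1 F) = 0 ∧ eval _ (pderiv 2 F) = 0 ∧
    eval _ (pderiv 3 F) = 0) ↔ _
  rw [e0, e1, e2, e3, e4]

lemma lin_two (b1 b3 Y1 W1 Y2 W2 : K) (h : Y1 * W2 - Y2 * W1 ≠ 0)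
    (e1 : b1 * Y1 + b3 * W1 = 0) (e2 : b1 * Y2 + b3 * W2 = 0) : b1 = 0 ∧ b3 = 0 := by
  constructor
  · apply mul_right_cancel₀ h
    linear_combination W2 * e1 - W1 * e2
  · apply mul_right_cancel₀ h
    linear_combination Y1 * e2 - Y2 * e1

lemma quad_three (a b c Y1 W1 Y2 W2 Y3 W3 : K) (h12 : Y1 * W2 - Y2 * W1 ≠ 0)
    (h13 : Y1 * W3 - Y3 * W1 ≠ 0) (h23 : Y2 * W3 - Y3 * W2 ≠ 0)
    (e1 : a * Y1 ^ 2 + b * (Y1 * W1) + c * W1 ^ 2 = 0)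
    (e2 : a * Y2 ^ 2 + b * (Y2 * W2) + c * W2 ^ 2 = 0)
    (e3 : a * Y3 ^ 2 + b * (Y3 * W3) + c * W3 ^ 2 = 0) : a = 0 ∧ b = 0 ∧ c = 0 := by
  have hD := mul_ne_zero (mul_ne_zero h12 h13) h23
  refine ⟨?_, ?_, ?_⟩
  · apply mul_right_cancel₀ hD
    linear_combination (Y2 * W2 * W3 ^ 2 - Y3 * W3 * W2 ^ 2) * e1
      - (Y1 * W1 * W3 ^ 2 - Y3 * W3 * W1 ^ 2) * e2 + (Y1 * W1 * W2 ^ 2 - Y2 * W2 * W1 ^ 2) * e3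
  · apply mul_right_cancel₀ hD
    linear_combination -(Y2 ^ 2 * W3 ^ 2 - Y3 ^ 2 * W2 ^ 2) * e1
      + (Y1 ^ 2 * W3 ^ 2 - Y3 ^ 2 * W1 ^ 2) * e2 - (Y1 ^ 2 * W2 ^ 2 - Y2 ^ 2 * W1 ^ 2) * e3
  · apply mul_right_cancel₀ hD
    linear_combination (Y2 ^ 2 * (Y3 * W3) - Y3 ^ 2 * (Y2 * W2)) * e1
      - (Y1 ^ 2 * (Y3 * W3) - Y3 ^ 2 * (Y1 * W1)) * e2
      + (Y1 ^ 2 * (Y2 * W2) - Y2 ^ 2 * (Y1 * W1)) * e3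

/-- A nonzero binary quartic in characteristic two has at most two multiple roots. -/
lemma binary_quartic [CharP K 2] (b0 b1 b2 b3 b4 y1 w1 y2 w2 y3 w3 : K)
    (h12 : y1 * w2 - y2 * w1 ≠ 0) (h13 : y1 * w3 - y3 * w1 ≠ 0) (h23 : y2 * w3 - y3 * w2 ≠ 0)
    (e : ∀ y w, (y = y1 ∧ w = w1) ∨ (y = y2 ∧ w = w2) ∨ (y = y3 ∧ w = w3) →
      b0 * y ^ 4 + b1 * (y ^ 3 * w) + b2 * (y ^ 2 * w ^ 2) + b3 * (y * w ^ 3) + b4 * w ^ 4 = 0 ∧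
      b1 * (y ^ 2 * w) + b3 * w ^ 3 = 0 ∧ b1 * y ^ 3 + b3 * (y * w ^ 2) = 0) :
    b0 = 0 ∧ b1 = 0 ∧ b2 = 0 ∧ b3 = 0 ∧ b4 = 0 := by
  have two : (2 : K) = 0 := CharTwo.two_eq_zero
  have sq : ∀ y w y' w' : K, y * w' - y' * w ≠ 0 → y ^ 2 * w' ^ 2 - y' ^ 2 * w ^ 2 ≠ 0 := by
    intro y w y' w' h h'
    apply pow_ne_zero 2 h
    linear_combination h' + (y' ^ 2 * w ^ 2 - y * w' * y' * w) * two
  have red : ∀ y w : K, (y ≠ 0 ∨ w ≠ 0) → b1 * (y ^ 2 * w) + b3 * w ^ 3 = 0 →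
      b1 * y ^ 3 + b3 * (y * w ^ 2) = 0 → b1 * y ^ 2 + b3 * w ^ 2 = 0 := by
    rintro y w (h | h) h1 h2
    · apply mul_left_cancel₀ h
      linear_combination h2
    · apply mul_left_cancel₀ h
      linear_combination h1
  have n1 : y1 ≠ 0 ∨ w1 ≠ 0 := by
    by_contra hh
    push Not at hh
    rw [hh.1, hh.2] at h12
    simp at h12
  have n2 : y2 ≠ 0 ∨ w2 ≠ 0 := by
    by_contra hh
    push Not at hh
    rw [hh.1, hh.2] at h12
    simp at h12
  obtain ⟨p1, q1, r1⟩ := e y1 w1 (by simp)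
  obtain ⟨p2, q2, r2⟩ := e y2 w2 (by simp)
  obtain ⟨p3, q3, r3⟩ := e y3 w3 (by simp)
  obtain ⟨rfl, rfl⟩ := lin_two b1 b3 _ _ _ _ (sq _ _ _ _ h12) (red _ _ n1 q1 r1) (red _ _ n2 q2 r2)
  obtain ⟨rfl, rfl, rfl⟩ := quad_three b0 b2 b4 _ _ _ _ _ _ (sq _ _ _ _ h12) (sq _ _ _ _ h13)
    (sq _ _ _ _ h23) (by linear_combination p1) (by linear_combination p2)
    (by linear_combination p3)
  simp

lemma irr_not_dvd {F H : MvPolynomial (Fin 4) K} (hF : F.IsHomogeneous 4) (hirr : Irreducible F)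
    (h : F = X 0 * H) : False := by
  rcases hirr.isUnit_or_isUnit h with hu | hu
  · have := hu.map (eval (0 : Fin 4 → K))
    simp at this
  · obtain ⟨r, hr, rfl⟩ := MvPolynomial.isUnit_iff_eq_C_of_isReduced.1 hu
    have h1 : F.IsHomogeneous (1 + 0) := by
      rw [h]
      exact (isHomogeneous_X K 0).mul (isHomogeneous_C _ r)
    have := hF.inj_right h1 hirr.ne_zero
    omega

end helpers

/-- Uniplanar separable case i): `F = z²x₁² + zG + B` with `G ≠ 0` homogeneous of degree 3
divisible by `x₁`, `B` homogeneous of degree 4, `X` irreducible with finite singular locus,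
over an algebraically closed field of characteristic 2.  Then `|Sing(X)| ≤ 17`. -/
theorem uniplanar_x1_divides_G_singular_count_le_seventeen
    {K : Type*} [Field K] [IsAlgClosed K] [CharP K 2]
    (G B : MvPolynomial (Fin 3) K)
    (hGhom : G.IsHomogeneous 3) (hG0 : G ≠ 0) (hdvd : (X 0 : MvPolynomial (Fin 3) K) ∣ G)
    (hBhom : B.IsHomogeneous 4)
    (F : MvPolynomial (Fin 4) K)
    (hF : F = X 3 ^ 2 * X 0 ^ 2
        + X 3 * rename (Fin.castLE (by norm_num : (3:ℕ) ≤ 4)) G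
        + rename (Fin.castLE (by norm_num : (3:ℕ) ≤ 4)) B)
    (hFirr : Irreducible F) (hfin : (singLocus F).Finite) :
    (singLocus F).ncard ≤ 17 := by
  have two : (2 : K) = 0 := CharTwo.two_eq_zero
  have hInf : Infinite K := IsAlgClosed.instInfinite
  obtain ⟨q, rfl⟩ := hdvd
  have hq : q.IsHomogeneous 2 := hom_of_X_mul hGhom
  have hq0 : q ≠ 0 := right_ne_zero_of_mul hG0
  have hFhom : F.IsHomogeneous 4 := by
    rw [hF]
    refine IsHomogeneous.add (IsHomogeneous.add ?_ ?_) hBhom.rename_isHomogeneous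
    · exact ((isHomogeneous_X K (3 : Fin 4)).pow 2).mul ((isHomogeneous_X K (0 : Fin 4)).pow 2)
    · exact (isHomogeneous_X K (3 : Fin 4)).mul hGhom.rename_isHomogeneous
  have hS := sing_iff q B F hF
  have vec : ∀ v : Fin 4 → K, v = ![v 0, v 1, v 2, v 3] := by
    intro v
    funext i
    fin_cases i <;> rfl
  -- the square root
  have hsq : ∀ b : K, ∃ z, z ^ 2 = b := fun b => IsAlgClosed.exists_pow_nat_eq b (by norm_num)
  choose r hr using hsq
  -- the part with `x = 1`
  let f : MvPolynomial (Fin 3) K := B * (pderiv 1 q) ^ 2 + (pderiv 1 B) ^ 2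
  let g : MvPolynomial (Fin 3) K := B * (pderiv 2 q) ^ 2 + (pderiv 2 B) ^ 2
  have hf : f.IsHomogeneous 6 :=
    (hBhom.mul (hq.pderiv.pow 2)).add (hBhom.pderiv.pow 2)
  have hg : g.IsHomogeneous 6 :=
    (hBhom.mul (hq.pderiv.pow 2)).add (hBhom.pderiv.pow 2)
  let A : Set (K × K) := {p | eval ![1, p.1, p.2] q = 0 ∧ eval ![1, p.1, p.2] f = 0 ∧
    eval ![1, p.1, p.2] g = 0}
  have nz1 : ∀ y w z : K, (![1, y, w, z] : Fin 4 → K) ≠ 0 := by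
    intro y w z h
    simpa using congrFun h 0
  let ψ : K × K → Projectivization K (Fin 4 → K) := fun p =>
    Projectivization.mk K ![1, p.1, p.2, r (eval ![1, p.1, p.2] B)] (nz1 _ _ _)
  have hψinj : Function.Injective ψ := by
    rintro ⟨y, w⟩ ⟨y', w'⟩ h
    obtain ⟨c, hc⟩ := (Projectivization.mk_eq_mk_iff' K _ _ _ _).1 h
    have c0 : c = 1 := by simpa using congrFun hc 0
    have c1 : c * y' = y := by simpa using congrFun hc 1
    have c2 : c * w' = w := by simpa using congrFun hc 2
    rw [c0, one_mul] at c1 c2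
    rw [c1, c2]
  have hψA : ψ '' A ⊆ singLocus F := by
    rintro _ ⟨⟨y, w⟩, ⟨h1, h2, h3⟩, rfl⟩
    simp only at h1 h2 h3
    refine (sing_mem hFhom _ _).2 ?_
    simp only
    rw [hS]
    have hz := hr (eval ![1, y, w] B)
    set z := r (eval ![1, y, w] B)
    simp only [f, g, map_add, map_mul, map_pow] at h2 h3
    have k1 : z * (1 * eval ![1, y, w] (pderiv 1 q)) + eval ![1, y, w] (pderiv 1 B) = 0 := by
      rw [← hz] at h2
      apply pow_eq_zero_iff (two_ne_zero) |>.1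
      linear_combination h2 +
        z * eval ![1, y, w] (pderiv 1 q) * eval ![1, y, w] (pderiv 1 B) * two
    have k2 : z * (1 * eval ![1, y, w] (pderiv 2 q)) + eval ![1, y, w] (pderiv 2 B) = 0 := by
      rw [← hz] at h3
      apply pow_eq_zero_iff (two_ne_zero) |>.1
      linear_combination h3 +
        z * eval ![1, y, w] (pderiv 2 q) * eval ![1, y, w] (pderiv 2 B) * two
    have E1 := congrArg (eval ![1, y, w]) hBhom.sum_X_mul_pderiv
    have E2 := congrArg (eval ![1, y, w]) hq.sum_X_mul_pderiv
    simp [Fin.sum_univ_three, two, h1] at E1 E2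
    have four : (4 : K) = 0 := by linear_combination 2 * two
    rw [four, zero_mul] at E1
    refine ⟨?_, ?_, k1, k2, ?_⟩
    · rw [h1, ← hz]
      linear_combination z ^ 2 * two
    · rw [h1]
      linear_combination E1 + z * E2 - y * k1 - w * k2
    · rw [h1, mul_zero]
  have hAfin : A.Finite := Set.Finite.of_finite_image (hfin.subset hψA) hψinj.injOn
  have hAcard : A.ncard ≤ 14 := by
    obtain ⟨a, b, c, d, e, h, hqe⟩ := conic_form hq
    refine affine_count hf hg a b c d e h ?_ A hAfin ?_
    · rintro ⟨rfl, rfl, rfl, rfl, rfl, rfl⟩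
      exact hq0 (by rw [hqe]; simp)
    · intro y w
      have : eval ![1, y, w] q = a + b * y + c * w + d * y ^ 2 + e * (y * w) + h * w ^ 2 := by
        rw [hqe]; simp
      rw [← this]
      rfl
  -- the part with `x = 0`
  let S0 : Set (Projectivization K (Fin 4 → K)) := {p ∈ singLocus F | ∃ (v : Fin 4 → K) (hv : v ≠ 0),
    Projectivization.mk K v hv = p ∧ v 0 = 0 ∧ ¬ (v 1 = 0 ∧ v 2 = 0)}
  have hqne : ∀ y w z : K, ¬ (y = 0 ∧ w = 0) →
      (eval ![0, y, w, z] F = 0 ∧ ∀ i, eval ![0, y, w, z] (pderiv i F) = 0) →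
      eval ![0, y, w] q ≠ 0 := by
    intro y w z hyw hs hq
    have nz : ∀ z' : K, (![0, y, w, z'] : Fin 4 → K) ≠ 0 := by
      intro z' h
      exact hyw ⟨by simpa using congrFun h 1, by simpa using congrFun h 2⟩
    let χ : K → Projectivization K (Fin 4 → K) := fun z' => Projectivization.mk K _ (nz z')
    have hχ : Function.Injective χ := by
      intro z1 z2 h
      obtain ⟨c, hc⟩ := (Projectivization.mk_eq_mk_iff' K _ _ _ _).1 h
      have c1 : c * y = y := by simpa using congrFun hc 1
      have c2 : c * w = w := by simpa using congrFun hc 2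
      have c3 : c * z2 = z1 := by simpa using congrFun hc 3
      have : c = 1 := by
        by_cases hy : y = 0
        · have hw : w ≠ 0 := fun hw => hyw ⟨hy, hw⟩
          exact mul_right_cancel₀ hw (by rw [c2, one_mul])
        · exact mul_right_cancel₀ hy (by rw [c1, one_mul])
      rw [← c3, this, one_mul]
    rw [hS, hq] at hs
    refine (Set.infinite_range_of_injective hχ) (hfin.subset ?_)
    rintro _ ⟨z', rfl⟩
    refine (sing_mem hFhom _ _).2 ?_
    rw [hS, hq]
    simpa using hs
  have hS0 : S0.ncard ≤ 2 := by
    by_contra hlt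
    push Not at hlt
    obtain ⟨p1, m1, p2, m2, p3, m3, n12, n13, n23⟩ :=
      (Set.two_lt_ncard (hfin.subset (Set.sep_subset _ _))).1 hlt
    have eqv : ∀ p ∈ S0, ∃ (y w z : K) (hv : (![0, y, w, z] : Fin 4 → K) ≠ 0),
        Projectivization.mk K _ hv = p ∧ ¬ (y = 0 ∧ w = 0) ∧
        (eval ![0, y, w, z] F = 0 ∧ ∀ i, eval ![0, y, w, z] (pderiv i F) = 0) := by
      rintro p ⟨hp, v, hv, rfl, h0, h12⟩
      have hv' := vec v
      rw [h0] at hv'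
      refine ⟨v 1, v 2, v 3, hv' ▸ hv, ?_, h12, ?_⟩
      · congr 1
        exact hv'.symm
      · have := (sing_mem hFhom v hv).1 hp
        rwa [hv'] at this
    have prop : ∀ (y w z y' w' z' : K) (hv : (![0, y, w, z] : Fin 4 → K) ≠ 0)
        (hv' : (![0, y', w', z'] : Fin 4 → K) ≠ 0), ¬ (y = 0 ∧ w = 0) → ¬ (y' = 0 ∧ w' = 0) →
        (eval ![0, y, w, z] F = 0 ∧ ∀ i, eval ![0, y, w, z] (pderiv i F) = 0) →
        (eval ![0, y', w', z'] F = 0 ∧ ∀ i, eval ![0, y', w', z'] (pderiv i F) = 0) →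
        Projectivization.mk K _ hv ≠ Projectivization.mk K _ hv' → y * w' - y' * w ≠ 0 := by
      intro y w z y' w' z' hv hv' hyw hyw' hs hs' hne hdet
      apply hne
      rw [Projectivization.mk_eq_mk_iff']
      have hqn := hqne _ _ _ hyw' hs'
      obtain ⟨c, hc1, hc2⟩ : ∃ c, c * y' = y ∧ c * w' = w := by
        by_cases hy : y' = 0
        · have hw : w' ≠ 0 := fun hw => hyw' ⟨hy, hw⟩
          have hy0 : y = 0 := by
            rw [hy, zero_mul, sub_zero] at hdet
            exact (mul_eq_zero.1 hdet).resolve_right hw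
          exact ⟨w / w', by rw [hy, hy0, mul_zero], by field_simp⟩
        · exact ⟨y / y', by field_simp, by field_simp; linear_combination hdet⟩
      refine ⟨c, ?_⟩
      have hc0 : c ≠ 0 := by
        rintro rfl
        exact hyw ⟨by rw [← hc1, zero_mul], by rw [← hc2, zero_mul]⟩
      have hsm : (![0, y, w] : Fin 3 → K) = c • ![0, y', w'] := by
        simp [hc1, hc2]
      rw [hS] at hs hs'
      have t1 := hs.2.1
      have t2 := hs'.2.1
      rw [hsm, hom_eval_smul hq, hom_eval_smul hBhom.pderiv] at t1
      simp only [zero_mul, add_zero] at t1 t2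
      have hz : c * z' = z := by
        apply mul_right_cancel₀ (mul_ne_zero (pow_ne_zero 2 hc0) hqn)
        norm_num at t1
        linear_combination c ^ 3 * t2 - t1
      simp [hc1, hc2, hz]
    obtain ⟨y1, w1, z1, v1, rfl, u1, s1⟩ := eqv p1 m1
    obtain ⟨y2, w2, z2, v2, rfl, u2, s2⟩ := eqv p2 m2
    obtain ⟨y3, w3, z3, v3, rfl, u3, s3⟩ := eqv p3 m3
    have d12 := prop _ _ _ _ _ _ v1 v2 u1 u2 s1 s2 n12
    have d13 := prop _ _ _ _ _ _ v1 v3 u1 u3 s1 s3 n13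
    have d23 := prop _ _ _ _ _ _ v2 v3 u2 u3 s2 s3 n23
    obtain ⟨D, b0, b1, b2, b3, b4, hB⟩ := quartic_form hBhom
    have ev : ∀ y w z : K,
        (eval ![0, y, w, z] F = 0 ∧ ∀ i, eval ![0, y, w, z] (pderiv i F) = 0) →
        b0 * y ^ 4 + b1 * (y ^ 3 * w) + b2 * (y ^ 2 * w ^ 2) + b3 * (y * w ^ 3) + b4 * w ^ 4 = 0 ∧
        b1 * (y ^ 2 * w) + b3 * w ^ 3 = 0 ∧ b1 * y ^ 3 + b3 * (y * w ^ 2) = 0 := by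
      intro y w z hs
      rw [hS] at hs
      obtain ⟨t1, -, t2, t3, -⟩ := hs
      have four : (4 : K) = 0 := by linear_combination 2 * two
      have three : (3 : K) = 1 := by linear_combination two
      have x01 : pderiv (1 : Fin 3) (X 0 : MvPolynomial (Fin 3) K) = 0 :=
        pderiv_X_of_ne (by decide)
      have x21 : pderiv (1 : Fin 3) (X 2 : MvPolynomial (Fin 3) K) = 0 :=
        pderiv_X_of_ne (by decide)
      have x02 : pderiv (2 : Fin 3) (X 0 : MvPolynomial (Fin 3) K) = 0 :=
        pderiv_X_of_ne (by decide)
      have x12 : pderiv (2 : Fin 3) (X 1 : MvPolynomial (Fin 3) K) = 0 :=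
        pderiv_X_of_ne (by decide)
      rw [hB] at t1 t2 t3
      simp only [map_add, pderiv_mul, pderiv_pow, pderiv_C, pderiv_X_self, x01, x21, x02, x12,
        map_mul, map_pow, eval_X, eval_C] at t1 t2 t3
      simp [two, three, four] at t1 t2 t3
      exact ⟨by linear_combination t1, by linear_combination t2, by linear_combination t3⟩
    obtain ⟨rfl, rfl, rfl, rfl, rfl⟩ := binary_quartic b0 b1 b2 b3 b4 y1 w1 y2 w2 y3 w3 d12 d13 d23
      (by
        rintro y w (⟨rfl, rfl⟩ | ⟨rfl, rfl⟩ | ⟨rfl, rfl⟩)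
        · exact ev _ _ _ s1
        · exact ev _ _ _ s2
        · exact ev _ _ _ s3)
    refine irr_not_dvd (H := X 3 ^ 2 * X 0
      + X 3 * rename (Fin.castLE (by norm_num : (3:ℕ) ≤ 4)) q
      + rename (Fin.castLE (by norm_num : (3:ℕ) ≤ 4)) D) hFhom hFirr ?_
    rw [hF, hB]
    simp only [map_add, map_mul, map_zero, zero_mul, add_zero, rename_X]
    change _ + X 3 * (X 0 * _) + X 0 * _ = _
    ring
  -- the vertex
  have nzP : (![0, 0, 0, 1] : Fin 4 → K) ≠ 0 := fun h => by simpa using congrFun h 3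
  have hsub : singLocus F ⊆ ({Projectivization.mk K _ nzP} ∪ S0) ∪ ψ '' A := by
    intro p hp
    induction p using Projectivization.ind with
    | h v hv =>
    by_cases h0 : v 0 = 0
    · left
      by_cases h12 : v 1 = 0 ∧ v 2 = 0
      · left
        rw [Set.mem_singleton_iff, Projectivization.mk_eq_mk_iff']
        refine ⟨v 3, ?_⟩
        rw [vec v, h0, h12.1, h12.2]
        simp
      · right
        exact ⟨hp, v, hv, rfl, h0, h12⟩
    · right
      have hnz := nz1 (v 1 / v 0) (v 2 / v 0) (v 3 / v 0)
      have heq : Projectivization.mk K v hv = Projectivization.mk K _ hnz := by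
        rw [Projectivization.mk_eq_mk_iff']
        refine ⟨v 0, ?_⟩
        funext i
        fin_cases i <;> simp <;> field_simp
      rw [heq] at hp ⊢
      have hs := (sing_mem hFhom _ _).1 hp
      rw [hS] at hs
      generalize v 1 / v 0 = y at *
      generalize v 2 / v 0 = w at *
      generalize v 3 / v 0 = z at *
      obtain ⟨t1, -, t2, t3, t4⟩ := hs
      rw [one_mul] at t4
      have hBz : eval ![1, y, w] B = z ^ 2 := by
        rw [t4] at t1
        linear_combination t1 - z ^ 2 * two
      refine ⟨(y, w), ⟨t4, ?_, ?_⟩, ?_⟩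
      · simp only [f, map_add, map_mul, map_pow, hBz]
        linear_combination (z * eval ![1, y, w] (pderiv 1 q) + eval ![1, y, w] (pderiv 1 B)) * t2
          - z * eval ![1, y, w] (pderiv 1 q) * eval ![1, y, w] (pderiv 1 B) * two
      · simp only [g, map_add, map_mul, map_pow, hBz]
        linear_combination (z * eval ![1, y, w] (pderiv 2 q) + eval ![1, y, w] (pderiv 2 B)) * t3
          - z * eval ![1, y, w] (pderiv 2 q) * eval ![1, y, w] (pderiv 2 B) * two
      · have hz : r (eval ![1, y, w] B) = z := by
          have h1 := hr (eval ![1, y, w] B)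
          rw [hBz] at h1 ⊢
          have h2 : (r (z ^ 2) - z) ^ 2 = 0 := by
            linear_combination h1 + (z ^ 2 - r (z ^ 2) * z) * two
          exact sub_eq_zero.1 (pow_eq_zero_iff two_ne_zero |>.1 h2)
        simp only [ψ, hz]
  have hS0fin : S0.Finite := hfin.subset (Set.sep_subset _ _)
  calc (singLocus F).ncard ≤ _ := Set.ncard_le_ncard hsub
        (((Set.finite_singleton _).union hS0fin).union (hAfin.image _))
    _ ≤ _ := Set.ncard_union_le _ _
    _ ≤ (1 + 2) + 14 := by
        refine Nat.add_le_add ((Set.ncard_union_le _ _).trans (Nat.add_le_add ?_ hS0))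
          ((Set.ncard_image_le hAfin).trans hAcard)
        simp
    _ = 17 := rfl

end
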